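/- Let a₀, b₀, a₁, b₁ be integers with 0 ≤ a₁ ≤ q and 0 ≤ b₁ ≤ q, and set a = a₀(q+1) − a₁, b = b₀(q+1) − b₁ and d* = a + b. Assume 0 ≤ a + b ≤ q³ − 1, and assume either a + b > q, or (a + b ≤ q and a₁ ≠ 0 and b₁ ≠ 0). If a₀ + b₀ < a₁ < q and a₀ + b₀ < b₁ < q, then d(C((q−2)(q+1) + a, b)^⊥) = d* + a₁ + b₁ − 2(a₀ + b₀). (Theorem 3.3, cases 3 and 3′.) -/

import Mathlib

open scoped BigOperators

namespace HermitianTwoPoint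

/-- The affine points of the Hermitian curve `y^q + y = x^(q+1)` other than the origin. -/
def Dset (q : ℕ) (F : Type) [Field F] : Set (F × F) :=
  {P | P.2 ^ q + P.2 = P.1 ^ (q + 1) ∧ P ≠ 0}

/-- The exponent set describing a monomial basis of `L(m P∞ + n P₀)`. -/
def S (q : ℕ) (m n : ℤ) : Set (ℤ × ℤ) :=
  {ij | 0 ≤ ij.1 ∧ ij.1 ≤ (q : ℤ) ∧ (q : ℤ) * ij.1 + ((q : ℤ) + 1) * ij.2 ≤ m ∧
    -n ≤ ij.1 + ((q : ℤ) + 1) * ij.2}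

/-- Evaluation vector of the monomial `x^i y^j` at the points of `Dset`. -/
def evalVec (q : ℕ) (F : Type) [Field F] (ij : ℤ × ℤ) : ↥(Dset q F) → F :=
  fun P => (P : F × F).1 ^ ij.1 * (P : F × F).2 ^ ij.2

/-- The two-point Hermitian code `C(m,n)`. -/
noncomputable def Code (q : ℕ) (F : Type) [Field F] (m n : ℤ) :
    Submodule F (↥(Dset q F) → F) :=
  Submodule.span F (evalVec q F '' S q m n)

noncomputable instance (q : ℕ) (F : Type) [Field F] [Fintype F] : Fintype ↥(Dset q F) :=
  Fintype.ofFinite _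

/-- The dual code `C(m,n)^⊥`. -/
noncomputable def dualCode (q : ℕ) (F : Type) [Field F] [Fintype F] (m n : ℤ) :
    Set (↥(Dset q F) → F) :=
  {c | ∀ w ∈ Code q F m n, ∑ P, c P * w P = 0}

/-- Hamming weight of a word. -/
noncomputable def wt {q : ℕ} {F : Type} [Field F] (c : ↥(Dset q F) → F) : ℕ :=
  Nat.card {P // c P ≠ 0}

/-- Minimum distance of the dual code `C(m,n)^⊥`. -/
noncomputable def minDist (q : ℕ) (F : Type) [Field F] [Fintype F] (m n : ℤ) : ℕ :=
  sInf {w | ∃ c ∈ dualCode q F m n, c ≠ 0 ∧ wt c = w}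

section Helpers

open Finset

/-- Orthogonality to all monomials in the two-point Riemann–Roch space. -/
def Perp {F : Type} [Field F] (q : ℕ) (φ : ℕ → ℤ → F) (m n : ℤ) : Prop :=
  ∀ (i : ℕ) (j : ℤ), (q : ℤ) * i + ((q : ℤ) + 1) * j ≤ m → -n ≤ (i : ℤ) + ((q : ℤ) + 1) * j →
    φ i j = 0

/-- The recursion forced by the curve equation. -/
def Rec {F : Type} [Field F] (q : ℕ) (φ : ℕ → ℤ → F) : Prop :=
  ∀ (i : ℕ) (j : ℤ), φ (i + (q + 1)) j = φ i (j + q) + φ i (j + 1)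

lemma perp_of_S {F : Type} [Field F] {q : ℕ} {φ : ℕ → ℤ → F} (hq : 2 ≤ q) (hr : Rec q φ) {m n : ℤ}
    (h : ∀ (i : ℕ) (j : ℤ), i ≤ q → (q : ℤ) * i + ((q : ℤ) + 1) * j ≤ m →
      -n ≤ (i : ℤ) + ((q : ℤ) + 1) * j → φ i j = 0) : Perp q φ m n := by
  intro i
  induction i using Nat.strong_induction_on with
  | _ i ih =>
    intro j h1 h2
    by_cases hi : i ≤ q
    · exact h i j hi h1 h2
    · obtain ⟨k, rfl⟩ : ∃ k, i = k + (q + 1) := ⟨i - (q + 1), by omega⟩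
      have hq' : (2 : ℤ) ≤ q := by exact_mod_cast hq
      push_cast at h1 h2
      rw [hr, ih k (by omega) (j + q) (by nlinarith) (by nlinarith),
        ih k (by omega) (j + 1) (by nlinarith) (by nlinarith), add_zero]

lemma phi_eq {F : Type} [Field F] {q : ℕ} {φ : ℕ → ℤ → F} (hq : 2 ≤ q) (hr : Rec q φ) {r n : ℤ}
    (hp : Perp q φ (r - 1) n) : ∀ (i : ℕ) (j : ℤ), (q : ℤ) * i + ((q : ℤ) + 1) * j = r →
      -n ≤ (i : ℤ) + ((q : ℤ) + 1) * j →
      φ i j = φ (i % (q + 1)) (j + q * ((i / (q + 1) : ℕ) : ℤ)) := by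
  intro i
  induction i using Nat.strong_induction_on with
  | _ i ih =>
    intro j h1 h2
    by_cases hi : i < q + 1
    · rw [Nat.mod_eq_of_lt hi, Nat.div_eq_of_lt hi]; simp
    · obtain ⟨k, rfl⟩ : ∃ k, i = k + (q + 1) := ⟨i - (q + 1), by omega⟩
      have hq' : (2 : ℤ) ≤ q := by exact_mod_cast hq
      push_cast at h1 h2
      rw [hr, ih k (by omega) (j + q) (by nlinarith) (by nlinarith),
        hp k (j + 1) (by nlinarith) (by nlinarith), add_zero, Nat.add_mod_right,
        Nat.add_div_right _ (by omega)]
      congr 1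
      push_cast
      ring

lemma rho_inj {q : ℕ} {i k : ℕ} {j l : ℤ}
    (h : (q : ℤ) * i + ((q : ℤ) + 1) * j = (q : ℤ) * k + ((q : ℤ) + 1) * l) :
    i % (q + 1) = k % (q + 1) := by
  have : (i : ℤ) ≡ k [ZMOD ((q + 1 : ℕ) : ℤ)] := by
    rw [Int.modEq_iff_dvd]
    refine ⟨k + l - i - j, ?_⟩
    push_cast
    linarith
  exact (Int.natCast_modEq_iff.mp this)

lemma phi_same {F : Type} [Field F] {q : ℕ} {φ : ℕ → ℤ → F} (hq : 2 ≤ q) (hr : Rec q φ) {r n : ℤ}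
    (hp : Perp q φ (r - 1) n) (i k : ℕ) (j l : ℤ) (h1 : (q : ℤ) * i + ((q : ℤ) + 1) * j = r)
    (h2 : -n ≤ (i : ℤ) + ((q : ℤ) + 1) * j) (h3 : (q : ℤ) * k + ((q : ℤ) + 1) * l = r)
    (h4 : -n ≤ (k : ℤ) + ((q : ℤ) + 1) * l) : φ i j = φ k l := by
  have hm := rho_inj (h1.trans h3.symm)
  rw [phi_eq hq hr hp i j h1 h2, phi_eq hq hr hp k l h3 h4, hm]
  congr 1
  have e1 : ((i % (q + 1) : ℕ) : ℤ) + (q + 1) * ((i / (q + 1) : ℕ) : ℤ) = i := by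
    exact_mod_cast Nat.mod_add_div i (q + 1)
  have e2 : ((k % (q + 1) : ℕ) : ℤ) + (q + 1) * ((k / (q + 1) : ℕ) : ℤ) = k := by
    exact_mod_cast Nat.mod_add_div k (q + 1)
  rw [hm] at e1
  have hq0 : (0 : ℤ) < (q : ℤ) + 1 := by positivity
  apply mul_left_cancel₀ hq0.ne'
  linear_combination h1 - h3 + (q : ℤ) * e1 - (q : ℤ) * e2

/-- The functional attached to weights `c` on points `(U, V)`. -/
def ph {F W : Type} [Field F] [Fintype W] (c U V : W → F) (i : ℕ) (j : ℤ) : F :=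
  ∑ w, c w * (U w ^ i * V w ^ j)

lemma ph_rec {F W : Type} [Field F] [Fintype W] {q : ℕ} {c U V : W → F}
    (hV : ∀ w, V w ≠ 0) (hc : ∀ w, V w ^ q + V w = U w ^ (q + 1)) : Rec q (ph c U V) := by
  intro i j
  simp only [ph, ← Finset.sum_add_distrib]
  refine Finset.sum_congr rfl fun w _ => ?_
  rw [pow_add, ← hc w, zpow_add₀ (hV w), zpow_add₀ (hV w), zpow_natCast, zpow_one]
  ring

lemma order_bound {F W : Type} [Field F] [Fintype W] {q : ℕ} {c U V : W → F} (hq : 2 ≤ q)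
    (hV : ∀ w, V w ≠ 0) (hc : ∀ w, V w ^ q + V w = U w ^ (q + 1)) {m n n1 n2 : ℤ}
    (hn : n = n1 + n2)
    (hp : Perp q (ph c U V) (m - 1) n) (hnp : ¬ Perp q (ph c U V) m n)
    {ι : Type} [Fintype ι] (I J : ι → ℕ) (hI : ∀ k, I k ≤ q)
    (hinj : ∀ k l, I k = I l → J k = J l → k = l)
    (h1 : ∀ k, -n1 ≤ (I k : ℤ) + ((q : ℤ) + 1) * J k)
    (h2 : ∀ k, ∃ (i : ℕ) (j : ℤ), (q : ℤ) * I k + ((q : ℤ) + 1) * J k +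
      ((q : ℤ) * i + ((q : ℤ) + 1) * j) = m ∧ -n2 ≤ (i : ℤ) + ((q : ℤ) + 1) * j) :
    Fintype.card ι ≤ Fintype.card W := by
  classical
  have hr := ph_rec (c := c) hV hc
  obtain ⟨i0, j0, e1, e2, e3⟩ : ∃ (i : ℕ) (j : ℤ), (q : ℤ) * i + ((q : ℤ) + 1) * j = m ∧
      -n ≤ (i : ℤ) + ((q : ℤ) + 1) * j ∧ ph c U V i j ≠ 0 := by
    unfold Perp at hnp
    push Not at hnp
    obtain ⟨i, j, a1, a2, a3⟩ := hnp
    refine ⟨i, j, ?_, a2, a3⟩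
    by_contra hne
    exact a3 (hp i j (by omega) a2)
  have hli : LinearIndependent F (fun k : ι => (fun w : W => U w ^ I k * V w ^ J k)) := by
    rw [Fintype.linearIndependent_iff]
    intro x hx
    by_contra! hcon
    obtain ⟨k0, hk0⟩ := hcon
    obtain ⟨k, hk, hmax⟩ := Finset.exists_max_image (univ.filter fun k => x k ≠ 0)
      (fun k => (q : ℤ) * I k + ((q : ℤ) + 1) * J k) ⟨k0, by simpa using hk0⟩
    simp only [mem_filter, mem_univ, true_and] at hk hmax
    obtain ⟨i, j, b1, b2⟩ := h2 k
    have key : ∑ l, x l * ph c U V (I l + i) (J l + j) = 0 := by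
      have : ∀ w, ∑ l, x l * (U w ^ I l * V w ^ J l) = 0 := fun w => by
        have := congrFun hx w
        simpa [Finset.sum_apply] using this
      calc ∑ l, x l * ph c U V (I l + i) (J l + j)
          = ∑ w, (c w * U w ^ i * V w ^ j) * ∑ l, x l * (U w ^ I l * V w ^ J l) := by
            simp only [ph, Finset.mul_sum]
            rw [Finset.sum_comm]
            refine Finset.sum_congr rfl fun w _ => Finset.sum_congr rfl fun l _ => ?_
            rw [zpow_add₀ (hV w), zpow_natCast, pow_add]
            ring
        _ = 0 := by simp [this]
    rw [Finset.sum_eq_single k] at key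
    · rcases mul_eq_zero.mp key with h | h
      · exact hk h
      · apply e3
        rw [← h]
        apply phi_same hq hr hp _ _ _ _ e1 e2
        · push_cast; linarith
        · have := h1 k; push_cast; linarith
    · intro l _ hlk
      by_cases hxl : x l = 0
      · simp [hxl]
      have hle := hmax l hxl
      have hne : (q : ℤ) * I l + ((q : ℤ) + 1) * J l ≠ (q : ℤ) * I k + ((q : ℤ) + 1) * J k := by
        intro he
        have hm := rho_inj he
        rw [Nat.mod_eq_of_lt (by have := hI l; omega), Nat.mod_eq_of_lt (by have := hI k; omega)]
          at hm
        apply hlk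
        apply hinj _ _ hm
        rw [hm] at he
        have hq0 : (0 : ℤ) < (q : ℤ) + 1 := by positivity
        have := mul_left_cancel₀ hq0.ne' (add_left_cancel he)
        exact_mod_cast this
      rw [hp (I l + i) (J l + j), mul_zero]
      · have := lt_of_le_of_ne hle hne
        push_cast
        rw [mul_add, mul_add]
        omega
      · have := h1 l; push_cast; linarith
    · simp
  have := hli.fintype_card_le_finrank
  simpa using this

lemma stepA {F W : Type} [Field F] [Fintype W] {q : ℕ} {c U V : W → F} (hq : 2 ≤ q)
    (hV : ∀ w, V w ≠ 0) (hc : ∀ w, V w ^ q + V w = U w ^ (q + 1)) {m n M0 N0 N1 : ℤ}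
    (x t : ℕ) (hxq : x ≤ q + 1) (hN1 : N1 ≤ q + 1)
    (ht : (t : ℤ) = M0 + N0 - x + 1) (hm : m = M0 * (q + 1) - (x - 1))
    (hn : n = N0 * (q + 1) - N1) (hw : Fintype.card W < x * t)
    (hp : Perp q (ph c U V) (m - 1) n) : Perp q (ph c U V) m n := by
  by_contra hnp
  have := order_bound (n1 := 0) (n2 := n) hq hV hc (by ring) hp hnp (ι := Fin x × Fin t)
    (fun k => k.1) (fun k => k.2) (fun k => by have := k.1.2; omega)
    (fun k l h1 h2 => Prod.ext (Fin.ext h1) (Fin.ext h2)) (fun k => by positivity) ?_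
  · simp at this; omega
  · rintro ⟨⟨i, hi⟩, ⟨j, hj⟩⟩
    refine ⟨x - 1 - i, M0 - (x - 1) - j, ?_, ?_⟩
    · have : ((x - 1 - i : ℕ) : ℤ) = x - 1 - i := by omega
      rw [this, hm]; simp only; ring
    · have h1 : (1 - N0 : ℤ) ≤ M0 - (x - 1) - j := by omega
      have : ((q : ℤ) + 1) * (1 - N0) ≤ ((q : ℤ) + 1) * (M0 - (x - 1) - j) :=
        mul_le_mul_of_nonneg_left h1 (by positivity)
      have h0 : (0 : ℤ) ≤ ((x - 1 - i : ℕ) : ℤ) := by positivity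
      rw [hn]; linarith

lemma stepC {F W : Type} [Field F] [Fintype W] {q : ℕ} {c U V : W → F} (hq : 2 ≤ q)
    (hV : ∀ w, V w ≠ 0) (hc : ∀ w, V w ^ q + V w = U w ^ (q + 1)) {m n N0 : ℤ} (N1 : ℕ)
    (hN1 : N1 ≤ q + 1)
    (hn : n = N0 * (q + 1) - N1) (hw : (Fintype.card W : ℤ) < m + n - (q ^ 2 - q - 1))
    (hp : Perp q (ph c U V) (m - 1) n) : Perp q (ph c U V) m n := by
  by_contra hnp
  obtain ⟨M0, M1, hM1, hm⟩ : ∃ (M0 : ℤ) (M1 : ℕ), M1 ≤ q ∧ m = M0 * (q + 1) - M1 := by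
    have hpos : (0 : ℤ) < (q : ℤ) + 1 := by positivity
    have h1 := Int.emod_nonneg (-m) hpos.ne'
    have h2 := Int.emod_lt_of_pos (-m) hpos
    have h3 := Int.emod_add_mul_ediv (-m) ((q : ℤ) + 1)
    refine ⟨-((-m) / ((q : ℤ) + 1)), ((-m) % ((q : ℤ) + 1)).toNat, by omega, ?_⟩
    rw [Int.toNat_of_nonneg h1]
    linarith
  set T : ℤ := M0 + N0 - M1 + 1 with hT
  let δ : ℕ → ℕ := fun i => if i < N1 then 1 else 0
  let ε : ℕ → ℕ := fun i => if M1 < i then 1 else 0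
  let len : ℕ → ℕ := fun i => (T - q * ε i - δ i).toNat
  have := order_bound (n1 := -N1) (n2 := N0 * (q + 1)) hq hV hc (by rw [hn]; ring) hp hnp
    (ι := Σ i : Fin (q + 1), Fin (len i))
    (fun k => k.1) (fun k => δ k.1 + k.2) (fun k => by have := k.1.2; omega) ?_ ?_ ?_
  · rw [Fintype.card_sigma] at this
    simp only [Fintype.card_fin] at this
    rw [Fin.sum_univ_eq_sum_range len] at this
    have h1 : ∑ i ∈ range (q + 1), (T - q * ε i - δ i) ≤ ((∑ i ∈ range (q + 1), len i : ℕ) : ℤ) := by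
      push_cast
      exact Finset.sum_le_sum fun i _ => Int.self_le_toNat _
    have h2 : ∑ i ∈ range (q + 1), (δ i : ℤ) ≤ N1 := by
      have : ∑ i ∈ range (q + 1), δ i ≤ N1 := by
        simp only [δ, Finset.sum_boole]
        refine le_trans (Finset.card_le_card (t := range N1) ?_) (by simp)
        intro i; simp
      exact_mod_cast this
    have h3 : ∑ i ∈ range (q + 1), (ε i : ℤ) ≤ q - M1 := by
      have : ∑ i ∈ range (q + 1), ε i ≤ q - M1 := by
        simp only [ε, Finset.sum_boole]
        refine le_trans (Finset.card_le_card (t := Ioc M1 q) ?_) (by simp)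
        intro i; simp; omega
      have h := (Int.ofNat_le.mpr this)
      push_cast [hM1] at h
      exact h
    rw [Finset.sum_sub_distrib, Finset.sum_sub_distrib, ← Finset.mul_sum] at h1
    simp only [sum_const, card_range, nsmul_eq_mul] at h1
    have h4 : (q : ℤ) * ∑ i ∈ range (q + 1), (ε i : ℤ) ≤ q * (q - M1) :=
      mul_le_mul_of_nonneg_left h3 (by positivity)
    have h5 : ((∑ i ∈ range (q + 1), len i : ℕ) : ℤ) ≤ Fintype.card W := by exact_mod_cast this
    push_cast at h1 h5
    rw [hm, hn] at hw
    nlinarith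
  · rintro ⟨i, j⟩ ⟨k, l⟩ h1 h2
    obtain rfl : i = k := Fin.ext h1
    simp only [add_right_inj] at h2
    obtain rfl := Fin.ext h2
    rfl
  · rintro ⟨⟨i, hi⟩, ⟨j, hj⟩⟩
    simp only [δ]
    split_ifs
    · push_cast; nlinarith
    · push_cast; nlinarith
  · rintro ⟨⟨i, hi⟩, ⟨j, hj⟩⟩
    simp only [len] at hj ⊢
    have hj' : (j : ℤ) < T - q * ε i - δ i := by omega
    have fin : ∀ y : ℤ, -N0 ≤ y → ∀ k : ℕ, -(N0 * ((q : ℤ) + 1)) ≤ (k : ℤ) + ((q : ℤ) + 1) * y := by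
      intro y hy k
      have : ((q : ℤ) + 1) * (-N0) ≤ ((q : ℤ) + 1) * y :=
        mul_le_mul_of_nonneg_left hy (by positivity)
      have h0 : (0 : ℤ) ≤ k := by positivity
      linarith
    by_cases h : M1 < i
    · have hε : ε i = 1 := by simp [ε, h]
      rw [hε] at hj'
      refine ⟨M1 + (q + 1) - i, M0 - M1 - q - (δ i + j : ℕ), ?_, ?_⟩
      · have : ((M1 + (q + 1) - i : ℕ) : ℤ) = M1 + (q + 1) - i := by omega
        rw [this, hm]; ring
      · apply fin
        push_cast at hj' ⊢
        omega
    · have hε : ε i = 0 := by simp [ε, h]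
      rw [hε] at hj'
      refine ⟨M1 - i, M0 - M1 - (δ i + j : ℕ), ?_, ?_⟩
      · have : ((M1 - i : ℕ) : ℤ) = M1 - i := by omega
        rw [this, hm]; ring
      · apply fin
        push_cast at hj' ⊢
        omega

lemma phaseA {F W : Type} [Field F] [Fintype W] {q : ℕ} {c U V : W → F} (hq : 2 ≤ q)
    (hV : ∀ w, V w ≠ 0) (hc : ∀ w, V w ^ q + V w = U w ^ (q + 1)) {n M0 N0 N1 : ℤ}
    (s a1 : ℕ) (hs : s ≤ a1) (haq : a1 < q) (hN1 : N1 ≤ q + 1)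
    (hMN : M0 + N0 = q - 2 + s)
    (hn : n = N0 * (q + 1) - N1) (hw : Fintype.card W < s * (q - 1))
    (hp : Perp q (ph c U V) (M0 * (q + 1) - a1) n) :
    Perp q (ph c U V) (M0 * (q + 1) - s) n := by
  obtain ⟨k, rfl⟩ := Nat.exists_eq_add_of_le hs
  induction k with
  | zero => simpa using hp
  | succ k ih =>
    refine ih (by omega) (by omega) ?_
    refine stepA (M0 := M0) hq hV hc (s + k + 1) (q - 2 - k) (by omega) hN1 ?_ ?_ hn ?_
      (N1 := N1) ?_
    · have : ((q - 2 - k : ℕ) : ℤ) = q - 2 - k := by omega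
      rw [this]; push_cast; linarith
    · push_cast; ring
    · refine lt_of_lt_of_le hw ?_
      obtain ⟨y, rfl⟩ : ∃ y, q = s + k + 2 + y := ⟨q - (s + k + 2), by omega⟩
      have e1 : s + k + 2 + y - 2 - k = s + y := by omega
      have e2 : s + k + 2 + y - 1 = s + k + 1 + y := by omega
      rw [e1, e2]
      nlinarith [Nat.zero_le (k * y), Nat.zero_le y]
    · convert hp using 1
      push_cast; ring

lemma phaseC {F W : Type} [Field F] [Fintype W] {q : ℕ} {c U V : W → F} (hq : 2 ≤ q)
    (hV : ∀ w, V w ≠ 0) (hc : ∀ w, V w ^ q + V w = U w ^ (q + 1)) {m n N0 : ℤ} (N1 : ℕ)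
    (hN1 : N1 ≤ q + 1)
    (hn : n = N0 * (q + 1) - N1) (hw : (Fintype.card W : ℤ) < m + 1 + n - (q ^ 2 - q - 1))
    (hp : Perp q (ph c U V) m n) (k : ℕ) : Perp q (ph c U V) (m + k) n := by
  induction k with
  | zero => simpa using hp
  | succ k ih =>
    refine stepC hq hV hc N1 hN1 hn ?_ ?_
    · push_cast
      have : (0 : ℤ) ≤ k := by positivity
      linarith
    · convert ih using 1
      push_cast; ring

lemma sep {F W : Type} [Field F] [Fintype F] [Fintype W] {c U V : W → F}
    (hV : ∀ w, V w ≠ 0) (hinj : ∀ w z, U w = U z → V w = V z → w = z) (j0 : ℤ)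
    (h : ∀ (i j : ℕ), ph c U V i (j0 + j) = 0) : ∀ w, c w = 0 := by
  classical
  have h1 : ∀ p r : Polynomial F, ∑ w, c w * V w ^ j0 * (p.eval (U w) * r.eval (V w)) = 0 := by
    intro p r
    simp only [Polynomial.eval_eq_sum, Polynomial.sum]
    simp_rw [Finset.sum_mul_sum, Finset.mul_sum]
    rw [Finset.sum_comm]
    refine Finset.sum_eq_zero fun i _ => ?_
    rw [Finset.sum_comm]
    refine Finset.sum_eq_zero fun j _ => ?_
    have := h i j
    rw [← mul_zero (p.coeff i * r.coeff j), ← this, ph, Finset.mul_sum]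
    refine Finset.sum_congr rfl fun w _ => ?_
    rw [zpow_add₀ (hV w), zpow_natCast]
    ring
  have ind : ∀ x : F, ∃ p : Polynomial F, ∀ y, p.eval y = if y = x then 1 else 0 := by
    intro x
    refine ⟨1 - (Polynomial.X - Polynomial.C x) ^ (Fintype.card F - 1), fun y => ?_⟩
    have hc1 : 1 < Fintype.card F := Fintype.one_lt_card
    split_ifs with hy
    · simp [hy]; omega
    · simp [FiniteField.pow_card_sub_one_eq_one _ (sub_ne_zero.mpr hy)]
  intro w
  obtain ⟨p, hp⟩ := ind (U w)
  obtain ⟨r, hr⟩ := ind (V w)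
  have := h1 p r
  rw [Finset.sum_eq_single w] at this
  · simp only [hp, hr, if_true, mul_one] at this
    exact (mul_eq_zero.mp this).resolve_right (zpow_ne_zero _ (hV w))
  · intro z _ hz
    rw [hp, hr]
    by_cases h1 : U z = U w
    · have : V z ≠ V w := fun h2 => hz (hinj _ _ h1 h2)
      simp [this]
    · simp [h1]
  · simp

lemma swap_perp {F W : Type} [Field F] [Fintype W] {q : ℕ} {c U V : W → F}
    (hV : ∀ w, V w ≠ 0) {m n : ℤ} (hp : Perp q (ph c U V) m n) :
    Perp q (ph c (fun w => U w / V w) (fun w => (V w)⁻¹)) n m := by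
  intro i j h1 h2
  have := hp i (-i - j) (by linarith) (by linarith)
  rw [← this, ph, ph]
  refine Finset.sum_congr rfl fun w _ => ?_
  rw [div_pow, zpow_sub₀ (hV w), zpow_neg, zpow_natCast, inv_zpow]
  ring

lemma lower {F W : Type} [Field F] [Fintype F] [Fintype W] {q : ℕ} {c U V : W → F} (hq : 2 ≤ q)
    (hV : ∀ w, V w ≠ 0) (hc : ∀ w, V w ^ q + V w = U w ^ (q + 1))
    (hinj : ∀ w z, U w = U z → V w = V z → w = z) {M0 N0 : ℤ} (s a1 b1 : ℕ)
    (hsa : s < a1) (haq : a1 < q) (hsb : s < b1) (hbq : b1 < q) (hMN : M0 + N0 = q - 2 + s)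
    (hw : Fintype.card W < s * (q - 1))
    (hp : Perp q (ph c U V) (M0 * (q + 1) - a1) (N0 * (q + 1) - b1)) : ∀ w, c w = 0 := by
  have hA := phaseA hq hV hc (N1 := b1) s a1 hsa.le haq (by omega) hMN rfl hw hp
  have hB := swap_perp hV hA
  have hV' : ∀ w, (V w)⁻¹ ≠ 0 := fun w => inv_ne_zero (hV w)
  have hc' : ∀ w, (V w)⁻¹ ^ q + (V w)⁻¹ = (U w / V w) ^ (q + 1) := by
    intro w
    have := hV w
    rw [div_pow, ← hc w, inv_pow]
    field_simp
    ring
  have hB' := phaseA hq hV' hc' (N1 := s) s b1 hsb.le hbq (by omega) (by linarith) rfl hw hB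
  have hC := phaseC hq hV' hc' s (by omega) rfl ?_ hB'
  · refine sep hV' ?_ (-M0 + 1) (U := fun w => U w / V w) ?_
    · intro w z h1 h2
      have h3 : V w = V z := inv_injective h2
      refine hinj _ _ ?_ h3
      simp only [h3] at h1
      exact (div_left_inj' (hV z)).mp h1
    · intro i j
      set r : ℤ := (q : ℤ) * i + ((q : ℤ) + 1) * (-M0 + 1 + j) with hr
      refine hC (r - (N0 * (q + 1) - s)).toNat i (-M0 + 1 + j) ?_ ?_
      · have := Int.self_le_toNat (r - (N0 * (q + 1) - s)); linarith
      · have : (0:ℤ) ≤ i + (q + 1) * j := by positivity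
        have : (s : ℤ) < q := by omega
        nlinarith
  · have : (Fintype.card W : ℤ) < s * (q - 1) := by
      have h := Int.ofNat_lt.mpr hw
      push_cast [show 1 ≤ q by omega] at h
      exact h
    nlinarith [congrArg (fun z : ℤ => z * (q + 1)) hMN]

lemma exists_perp {F W ι : Type} [Field F] [Fintype W] (B : Finset ι) (E : ι → W → F)
    (h : B.card < Fintype.card W) : ∃ c : W → F, c ≠ 0 ∧ ∀ b ∈ B, ∑ w, c w * E b w = 0 := by
  classical
  let L : (W → F) →ₗ[F] (B → F) :=
    { toFun := fun c b => ∑ w, c w * E b w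
      map_add' := fun x y => by
        funext b; simp [add_mul, Finset.sum_add_distrib]
      map_smul' := fun x y => by
        funext b; simp [Finset.mul_sum, mul_assoc] }
  have hker : LinearMap.ker L ≠ ⊥ := by
    apply LinearMap.ker_ne_bot_of_finrank_lt
    simpa using h
  obtain ⟨c, hc, hc0⟩ := Submodule.exists_mem_ne_zero_of_ne_bot hker
  refine ⟨c, hc0, fun b hb => ?_⟩
  exact congrFun (LinearMap.mem_ker.mp hc) ⟨b, hb⟩

/-- Number-of-elements helper: the indicator of `i < a`. -/
def dl (a i : ℕ) : ℤ := if i < a then 1 else 0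

lemma sum_dl (N a : ℕ) (h : a ≤ N) : ∑ i ∈ range N, dl a i = a := by
  simp only [dl, Finset.sum_boole]
  congr 1
  have : (range N).filter (fun i => i < a) = range a := by
    ext i; simp; omega
  rw [this, card_range]

/-- The exponent set as an explicit finset. -/
noncomputable def Sf (q : ℕ) (M0 N0 : ℤ) (M1 N1 : ℕ) : Finset (Σ _ : ℕ, ℤ) :=
  (range (q + 1)).sigma (fun i => Icc (-N0 + dl N1 i) (M0 - i - dl M1 i))

lemma aux_dl (q i N1 : ℕ) (hi : i ≤ q) (hN : N1 ≤ q) (y : ℤ) :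
    dl N1 i ≤ y ↔ (N1 : ℤ) ≤ i + (q + 1) * y := by
  unfold dl
  have hi' : (i : ℤ) ≤ q := by exact_mod_cast hi
  have hN' : (N1 : ℤ) ≤ q := by exact_mod_cast hN
  rcases lt_trichotomy y 0 with hy | hy | hy
  · have : ((q : ℤ) + 1) * y ≤ (q + 1) * (-1) := mul_le_mul_of_nonneg_left (by omega) (by positivity)
    split_ifs <;> constructor <;> intro h <;> omega
  · subst hy
    split_ifs <;> constructor <;> intro h <;> omega
  · have : ((q : ℤ) + 1) * 1 ≤ (q + 1) * y := mul_le_mul_of_nonneg_left (by omega) (by positivity)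
    split_ifs <;> constructor <;> intro h <;> omega

lemma mem_Sf {q : ℕ} {M0 N0 : ℤ} {M1 N1 : ℕ} (hM : M1 ≤ q) (hN : N1 ≤ q) (i : ℕ) (j : ℤ) :
    (⟨i, j⟩ : Σ _ : ℕ, ℤ) ∈ Sf q M0 N0 M1 N1 ↔
      i ≤ q ∧ (q : ℤ) * i + ((q : ℤ) + 1) * j ≤ M0 * (q + 1) - M1 ∧
        -(N0 * (q + 1) - N1) ≤ (i : ℤ) + ((q : ℤ) + 1) * j := by
  simp only [Sf, Finset.mem_sigma, mem_range, Nat.lt_succ_iff, mem_Icc]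
  refine and_congr_right fun hi => ?_
  have h1 := aux_dl q i N1 hi hN (j + N0)
  have h2 := aux_dl q i M1 hi hM (M0 - i - j)
  constructor
  · rintro ⟨a1, a2⟩
    have b1 := h1.mp (by linarith)
    have b2 := h2.mp (by linarith)
    constructor <;> nlinarith
  · rintro ⟨a1, a2⟩
    have b1 := h1.mpr (by nlinarith)
    have b2 := h2.mpr (by nlinarith)
    constructor <;> linarith

lemma card_Sf (q : ℕ) (M0 N0 : ℤ) (M1 N1 : ℕ) :
    (Sf q M0 N0 M1 N1).card =
      ∑ i ∈ range (q + 1), (M0 + N0 + 1 - i - dl M1 i - dl N1 i).toNat := by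
  rw [Sf, Finset.card_sigma]
  refine Finset.sum_congr rfl fun i _ => ?_
  rw [Int.card_Icc]
  congr 1
  ring

lemma card_diff {q : ℕ} {M0 N0 : ℤ} (s a1 b1 : ℕ) (hs : 1 ≤ s)
    (hsa : s < a1) (haq : a1 < q) (hsb : s < b1) (hbq : b1 < q) (hMN : M0 + N0 = q - 2 + s) :
    (Sf q M0 N0 a1 b1).card < s * (q - 1) + (Sf q (M0 - s) N0 (a1 - s) (b1 - s)).card := by
  rw [card_Sf, card_Sf]
  have h1 : ((∑ i ∈ range (q + 1), (M0 + N0 + 1 - i - dl a1 i - dl b1 i).toNat : ℕ) : ℤ) =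
      ∑ i ∈ range (q + 1), ((q : ℤ) - 1 + s - i - dl a1 i - dl b1 i) := by
    push_cast
    refine Finset.sum_congr rfl fun i hi => ?_
    have hi := mem_range.mp hi
    rw [show M0 + N0 + 1 = (q : ℤ) - 1 + s by linarith]
    simp only [dl]
    split_ifs <;> omega
  have h2 : ∑ i ∈ range q, ((q : ℤ) - 1 - i - dl (a1 - s) i - dl (b1 - s) i) ≤
      ((∑ i ∈ range (q + 1), (M0 - s + N0 + 1 - i - dl (a1 - s) i - dl (b1 - s) i).toNat : ℕ) : ℤ)
      := by
    rw [Finset.sum_range_succ, Nat.cast_add, Nat.cast_sum]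
    have : ∑ i ∈ range q, ((q : ℤ) - 1 - i - dl (a1 - s) i - dl (b1 - s) i) ≤
      ∑ i ∈ range q, (((M0 - s + N0 + 1 - i - dl (a1 - s) i - dl (b1 - s) i).toNat : ℕ) : ℤ) := by
      refine Finset.sum_le_sum fun i _ => ?_
      rw [show M0 - s + N0 + 1 = (q : ℤ) - 1 by linarith]
      exact Int.self_le_toNat _
    exact le_trans this (le_add_of_nonneg_right (Int.natCast_nonneg _))
  rw [Finset.sum_sub_distrib, Finset.sum_sub_distrib, sum_dl _ _ (by omega),
    sum_dl _ _ (by omega)] at h1 h2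
  have h3 : ∑ i ∈ range (q + 1), ((q : ℤ) - 1 + s - i) =
      ∑ i ∈ range q, ((q : ℤ) - 1 - i) + q * s + (s - 1) := by
    rw [Finset.sum_range_succ]
    have : ∑ i ∈ range q, ((q : ℤ) - 1 + s - i) = ∑ i ∈ range q, (((q : ℤ) - 1 - i) + s) :=
      Finset.sum_congr rfl fun i _ => by ring
    rw [this, Finset.sum_add_distrib]
    simp
    ring
  zify [show 1 ≤ q by omega]
  push_cast [hsa.le, hsb.le] at h1 h2 ⊢
  rw [h1]
  linarith

lemma upper_core {F W : Type} [Field F] [Fintype W] {q : ℕ} {U V : W → F} (hq : 2 ≤ q)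
    (hV : ∀ w, V w ≠ 0) (hc : ∀ w, V w ^ q + V w = U w ^ (q + 1)) {M0 N0 : ℤ} (s a1 b1 : ℕ)
    (hs : 1 ≤ s)
    (hsa : s < a1) (haq : a1 < q) (hsb : s < b1) (hbq : b1 < q) (hMN : M0 + N0 = q - 2 + s)
    (hw : Fintype.card W = s * (q - 1)) (ε r : ℕ) (hsr : s = ε + 2 * r) (e : ℕ → F)
    (hrel : ∀ w, U w ^ s = ∑ k ∈ range r, e k * (U w ^ (ε + 2 * k) * V w ^ (r - k))) :
    ∃ c : W → F, c ≠ 0 ∧ Perp q (ph c U V) (M0 * (q + 1) - a1) (N0 * (q + 1) - b1) := by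
  classical
  have hq' : (2 : ℤ) ≤ q := by exact_mod_cast hq
  let τ : (Σ _ : ℕ, ℤ) → (Σ _ : ℕ, ℤ) := fun k =>
    ⟨(k.1 + s) % (q + 1), k.2 + q * (((k.1 + s) / (q + 1) : ℕ) : ℤ)⟩
  set S1 := Sf q M0 N0 a1 b1 with hS1
  set S2 := Sf q (M0 - s) N0 (a1 - s) (b1 - s) with hS2
  have canon : ∀ (i : ℕ) (j m n : ℤ), (q : ℤ) * i + ((q : ℤ) + 1) * j ≤ m →
      -n ≤ (i : ℤ) + ((q : ℤ) + 1) * j →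
      (q : ℤ) * ((i % (q + 1) : ℕ) : ℤ) + ((q : ℤ) + 1) * (j + q * ((i / (q + 1) : ℕ) : ℤ)) ≤ m ∧
      -n ≤ ((i % (q + 1) : ℕ) : ℤ) + ((q : ℤ) + 1) * (j + q * ((i / (q + 1) : ℕ) : ℤ)) := by
    intro i j m n h1 h2
    have e1 : ((i % (q + 1) : ℕ) : ℤ) + (q + 1) * ((i / (q + 1) : ℕ) : ℤ) = i := by
      exact_mod_cast Nat.mod_add_div i (q + 1)
    have h0 : (0 : ℤ) ≤ ((i / (q + 1) : ℕ) : ℤ) := by positivity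
    generalize ((i / (q + 1) : ℕ) : ℤ) = y at *
    generalize ((i % (q + 1) : ℕ) : ℤ) = z at *
    rw [← e1] at h1 h2
    constructor
    · linarith
    · have : 0 ≤ ((q : ℤ) + 1) * (q - 1) * y := by
        apply mul_nonneg (mul_nonneg (by linarith) (by linarith)) h0
      nlinarith
  have hcast : ((a1 - s : ℕ) : ℤ) = a1 - s := by omega
  have hcast' : ((b1 - s : ℕ) : ℤ) = b1 - s := by omega
  have mem2 : ∀ i j, (⟨i, j⟩ : Σ _ : ℕ, ℤ) ∈ S2 →
      (i ≤ q ∧ (q : ℤ) * ((i + s : ℕ) : ℤ) + ((q : ℤ) + 1) * j ≤ M0 * (q + 1) - a1 ∧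
      -(N0 * (q + 1) - b1) ≤ ((i + s : ℕ) : ℤ) + ((q : ℤ) + 1) * j) := by
    intro i j h
    rw [hS2, mem_Sf (by omega) (by omega), hcast, hcast'] at h
    obtain ⟨h1, h2, h3⟩ := h
    push_cast
    exact ⟨h1, by linarith, by linarith⟩
  have himg : S2.image τ ⊆ S1 := by
    intro x hx
    obtain ⟨⟨i, j⟩, hk, rfl⟩ := Finset.mem_image.mp hx
    obtain ⟨h1, h2, h3⟩ := mem2 i j hk
    rw [hS1, mem_Sf (by omega) (by omega)]
    exact ⟨Nat.lt_succ_iff.mp (Nat.mod_lt _ (by omega)), canon _ _ _ _ h2 h3⟩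
  have hinj : Set.InjOn τ S2 := by
    rintro ⟨i, j⟩ hk ⟨k, l⟩ hl h
    have hi := (mem2 i j hk).1
    have hk' := (mem2 k l hl).1
    simp only [τ, Sigma.mk.injEq, heq_eq_eq] at h
    obtain ⟨h1, h2⟩ := h
    have hik : i = k := by
      have : (i : ℕ) ≡ k [MOD (q + 1)] := Nat.ModEq.add_right_cancel' s h1
      have h4 : i % (q + 1) = k % (q + 1) := this
      rwa [Nat.mod_eq_of_lt (by omega), Nat.mod_eq_of_lt (by omega)] at h4
    subst hik
    simp at h2
    rw [h2]
  have hB : (S1 \ S2.image τ).card < Fintype.card W := by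
    rw [Finset.card_sdiff_of_subset himg, Finset.card_image_of_injOn hinj, hw]
    have h1 := card_diff s a1 b1 hs hsa haq hsb hbq hMN
    rw [← hS1, ← hS2] at h1
    have h2 := Finset.card_le_card himg
    rw [Finset.card_image_of_injOn hinj] at h2
    omega
  obtain ⟨c, hc0, hcB⟩ := exists_perp (S1 \ S2.image τ)
    (fun b w => U w ^ b.1 * V w ^ b.2) hB
  refine ⟨c, hc0, ?_⟩
  have hr := ph_rec (c := c) hV hc
  set φ := ph c U V with hφ
  have hfrel : ∀ (i : ℕ) (j : ℤ), φ (i + s) j =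
      ∑ k ∈ range r, e k * φ (i + (ε + 2 * k)) (j + (r - k : ℕ)) := by
    intro i j
    simp only [hφ, ph, Finset.mul_sum]
    rw [Finset.sum_comm]
    refine Finset.sum_congr rfl fun w _ => ?_
    rw [pow_add, hrel w, Finset.mul_sum, Finset.sum_mul, Finset.mul_sum]
    refine Finset.sum_congr rfl fun k _ => ?_
    rw [zpow_add₀ (hV w), zpow_natCast, pow_add]
    ring
  set m : ℤ := M0 * (q + 1) - a1 with hm
  set n : ℤ := N0 * (q + 1) - b1 with hn
  have main : ∀ k : ℕ, -n - 1 + k ≤ m → Perp q φ (-n - 1 + k) n := by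
    intro k
    induction k with
    | zero =>
      intro _ i j h1 h2
      exfalso
      have : (0 : ℤ) ≤ ((q : ℤ) - 1) * i := mul_nonneg (by linarith) (by positivity)
      push_cast at h1
      nlinarith
    | succ k ih =>
      intro hk
      push_cast at hk
      have hp : Perp q φ ((-n - 1 + (k + 1 : ℕ)) - 1) n := by
        have := ih (by linarith)
        convert this using 1
        push_cast; ring
      set R : ℤ := -n - 1 + (k + 1 : ℕ) with hR
      have hRm : R ≤ m := by rw [hR]; push_cast; linarith
      intro i j h1 h2
      rcases h1.lt_or_eq with h1 | h1
      · exact hp i j (by omega) h2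
      by_cases hmem : (⟨i % (q + 1), j + q * ((i / (q + 1) : ℕ) : ℤ)⟩ : Σ _ : ℕ, ℤ) ∈ S2.image τ
      · obtain ⟨⟨i', j'⟩, hk, hτ⟩ := Finset.mem_image.mp hmem
        obtain ⟨g1, g2, g3⟩ := mem2 i' j' hk
        simp only [τ, Sigma.mk.injEq, heq_eq_eq] at hτ
        have e1 : (((i' + s) % (q + 1) : ℕ) : ℤ) + (q + 1) * (((i' + s) / (q + 1) : ℕ) : ℤ)
            = ((i' + s : ℕ) : ℤ) := by
          exact_mod_cast Nat.mod_add_div (i' + s) (q + 1)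
        have e2 : ((i % (q + 1) : ℕ) : ℤ) + (q + 1) * ((i / (q + 1) : ℕ) : ℤ) = i := by
          exact_mod_cast Nat.mod_add_div i (q + 1)
        have hρ : (q : ℤ) * ((i' + s : ℕ) : ℤ) + ((q : ℤ) + 1) * j' = R := by
          rw [← h1, ← e1, ← e2, hτ.1]
          linear_combination ((q : ℤ) + 1) * hτ.2
        rw [phi_same hq hr hp i (i' + s) j j' h1 h2 hρ g3, hfrel]
        refine Finset.sum_eq_zero fun l hl => ?_
        have hl := mem_range.mp hl
        obtain ⟨d, rfl⟩ : ∃ d, r = l + 1 + d := ⟨r - (l + 1), by omega⟩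
        have hsub : l + 1 + d - l = d + 1 := by omega
        have hpos : 0 ≤ ((q : ℤ) - 1) * d := mul_nonneg (by linarith) (by positivity)
        rw [hp, mul_zero]
        · rw [← hρ, hsr, hsub]
          push_cast
          linarith
        · refine le_trans g3 ?_
          rw [hsr, hsub]
          push_cast
          linarith
      · rw [phi_eq hq hr hp i j h1 h2]
        refine hcB ⟨i % (q + 1), j + q * ((i / (q + 1) : ℕ) : ℤ)⟩ (Finset.mem_sdiff.mpr ⟨?_, hmem⟩)
        rw [hS1, mem_Sf (by omega) (by omega)]
        exact ⟨Nat.lt_succ_iff.mp (Nat.mod_lt _ (by omega)), canon _ _ _ _ (h1.le.trans hRm) h2⟩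
  intro i j h1 h2
  have : (0 : ℤ) ≤ ((q : ℤ) - 1) * i := mul_nonneg (by linarith) (by positivity)
  have hmn : 0 ≤ m + n + 1 := by nlinarith
  refine main (m + n + 1).toNat ?_ i j ?_ h2
  · rw [Int.toNat_of_nonneg hmn]; linarith
  · rw [Int.toNat_of_nonneg hmn]; linarith

/-- Field-theoretic input: a trace-one element outside the subfield, a trace-zero element. -/
lemma exists_elts {F : Type} [Field F] [Fintype F] {q : ℕ} (hq : 2 ≤ q) (hpp : IsPrimePow q)
    (hF : Fintype.card F = q ^ 2) :
    ∃ w v0 : F, w ^ q + w = 1 ∧ w ^ q ≠ w ∧ w ≠ 0 ∧ v0 ≠ 0 ∧ v0 ^ q + v0 = 0 := by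
  classical
  obtain ⟨p, k, hp, hk, rfl⟩ := hpp
  have hp' : p.Prime := hp.nat_prime
  have : Fact p.Prime := ⟨hp'⟩
  have : CharP F p := charP_of_card_eq_prime_pow (f := k * 2) (by rw [hF, pow_mul])
  set q := p ^ k with hqdef
  have hadd : ∀ x y : F, (x + y) ^ q = x ^ q + y ^ q := fun x y => add_pow_char_pow x y p k
  have hsub : ∀ x y : F, (x - y) ^ q = x ^ q - y ^ q := fun x y => sub_pow_char_pow x y k
  have hqq : ∀ x : F, (x ^ q) ^ q = x := fun x => by
    rw [← pow_mul, ← sq, ← hF, FiniteField.pow_card]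
  have hlt : ∀ a : F, ∃ y : F, y ^ q + a * y ≠ 0 := by
    intro a
    by_contra! hcon
    have hd : (Polynomial.C a * Polynomial.X : Polynomial F).degree < q :=
      lt_of_le_of_lt (Polynomial.degree_C_mul_X_le a) (by exact_mod_cast (by omega : 1 < q))
    have hne : (Polynomial.X ^ q + Polynomial.C a * Polynomial.X : Polynomial F) ≠ 0 :=
      (Polynomial.monic_X_pow_add hd).ne_zero
    have hdeg : (Polynomial.X ^ q + Polynomial.C a * Polynomial.X : Polynomial F).natDegree = q := by
      rw [Polynomial.natDegree_add_eq_left_of_degree_lt, Polynomial.natDegree_X_pow]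
      rwa [Polynomial.degree_X_pow]
    have := Polynomial.card_le_degree_of_subset_roots (Z := (univ : Finset F))
      (p := Polynomial.X ^ q + Polynomial.C a * Polynomial.X) (by
        intro x _
        rw [Polynomial.mem_roots hne]
        simpa using hcon x)
    rw [hdeg, Finset.card_univ, hF] at this
    nlinarith
  obtain ⟨y, hy⟩ := hlt (-1)
  obtain ⟨z, hz⟩ := hlt 1
  have hv0 : (y ^ q - y) ≠ 0 := by
    intro h; apply hy; linear_combination h
  have hv1 : (y ^ q - y) ^ q + (y ^ q - y) = 0 := by
    rw [hsub, hqq]; ring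
  have hτ : (z ^ q + z) ^ q = z ^ q + z := by rw [hadd, hqq]; ring
  have hz' : z ^ q + z ≠ 0 := by simpa using hz
  set x := z / (z ^ q + z) with hx
  have hx1 : x ^ q + x = 1 := by
    rw [hx, div_pow, hτ]; field_simp
  have hne0 : ∀ x : F, x ^ q + x = 1 → x ≠ 0 := by
    rintro x h rfl
    rw [zero_pow (by omega)] at h; simp at h
  by_cases hxx : x ^ q = x
  · refine ⟨x + (y ^ q - y), y ^ q - y, ?_, ?_, ?_, hv0, hv1⟩
    · rw [hadd]; linear_combination hx1 + hv1
    · rw [hadd, hxx]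
      intro h
      have h2 : (2 : F) ≠ 0 := by
        intro h2
        rw [hxx] at hx1
        have : (2 : F) * x = 1 := by linear_combination hx1
        rw [h2] at this; simp at this
      have : 2 * (y ^ q - y) = 0 := by linear_combination hv1 - h
      rcases mul_eq_zero.mp this with h3 | h3
      · exact h2 h3
      · exact hv0 h3
    · apply hne0
      rw [hadd]; linear_combination hx1 + hv1
  · exact ⟨x, y ^ q - y, hx1, hxx, hne0 x hx1, hv0, hv1⟩

lemma exists_points {F : Type} [Field F] [Fintype F] {q : ℕ} (hq : 2 ≤ q) (hpp : IsPrimePow q)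
    (hF : Fintype.card F = q ^ 2) (ε r : ℕ) (hε : ε ≤ 1) (hr : r ≤ q + 1) :
    ∃ (T : Finset (F × F)) (e : ℕ → F), T.card = (ε + 2 * r) * (q - 1) ∧
      ∀ P ∈ T, P.2 ≠ 0 ∧ P.2 ^ q + P.2 = P.1 ^ (q + 1) ∧
        P.1 ^ (ε + 2 * r) = ∑ k ∈ range r, e k * (P.1 ^ (ε + 2 * k) * P.2 ^ (r - k)) := by
  classical
  obtain ⟨w, v0, hw1, hwq, hw0, hv0, hv1⟩ := exists_elts hq hpp hF
  obtain ⟨g', hg'⟩ := IsCyclic.exists_generator (α := Fˣ)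
  have hord' : orderOf g' = q ^ 2 - 1 := by
    rw [orderOf_eq_card_of_forall_mem_zpowers hg', Nat.card_eq_fintype_card, Fintype.card_units, hF]
  set g : F := (g' : F) with hg
  have hg0 : g ≠ 0 := g'.ne_zero
  have hord : orderOf g = q ^ 2 - 1 := by rw [hg, orderOf_units, hord']
  have hfac : q ^ 2 - 1 = (q + 1) * (q - 1) := by
    obtain ⟨t, rfl⟩ : ∃ t, q = t + 1 := ⟨q - 1, by omega⟩
    simp only [Nat.add_sub_cancel]
    rw [Nat.sub_eq_iff_eq_add (Nat.one_le_pow _ _ (by omega))]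
    ring
  have hpow1 : ∀ x : F, x ≠ 0 → x ^ ((q + 1) * (q - 1)) = 1 := fun x hx => by
    rw [← hfac, ← hF]; exact FiniteField.pow_card_sub_one_eq_one x hx
  have hqq : ∀ x : F, (x ^ q) ^ q = x := fun x => by
    rw [← pow_mul, ← sq, ← hF, FiniteField.pow_card]
  have hnorm : ∀ x : F, (x ^ (q + 1)) ^ q = x ^ (q + 1) := fun x => by
    rw [← pow_mul, mul_comm, pow_mul, pow_succ, hqq, mul_comm, ← pow_succ]
  have hqs : ∀ x : F, x ^ (q + 1) = x ^ 2 * x ^ (q - 1) := fun x => by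
    rw [← pow_add]; congr 1; omega
  -- injectivity of the parametrisation
  have ginj : ∀ k l k' l' : ℕ, k < q + 1 → l < q - 1 → k' < q + 1 → l' < q - 1 →
      g ^ (k + (q + 1) * l) = g ^ (k' + (q + 1) * l') → k = k' ∧ l = l' := by
    intro k l k' l' h1 h2 h3 h4 h
    have b : ∀ k l : ℕ, k < q + 1 → l < q - 1 → k + (q + 1) * l < orderOf g := by
      intro k l h1 h2
      rw [hord, hfac]
      have : (q + 1) * (l + 1) ≤ (q + 1) * (q - 1) := Nat.mul_le_mul_left _ h2
      nlinarith
    have he := pow_injOn_Iio_orderOf (Set.mem_Iio.mpr (b k l h1 h2))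
      (Set.mem_Iio.mpr (b k' l' h3 h4)) h
    have e1 := congrArg (· % (q + 1)) he
    simp only [Nat.add_mul_mod_self_left, Nat.mod_eq_of_lt h1, Nat.mod_eq_of_lt h3] at e1
    subst e1
    refine ⟨rfl, ?_⟩
    have := Nat.add_left_cancel he
    exact Nat.eq_of_mul_eq_mul_left (by omega) this
  set X := range r ×ˢ range (q - 1) with hX
  let u : ℕ × ℕ → F := fun k => g ^ (k.1 + (q + 1) * k.2)
  have hu0 : ∀ k, u k ≠ 0 := fun k => pow_ne_zero _ hg0
  have huq : ∀ k, u k ^ (q - 1) = g ^ (k.1 * (q - 1)) := fun k => by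
    simp only [u]
    rw [← pow_mul, add_mul, pow_add, mul_right_comm, pow_mul g ((q + 1) * (q - 1)), hpow1 g hg0,
      one_pow, mul_one]
  have huinj : Set.InjOn u X := by
    rintro ⟨k, l⟩ h1 ⟨k', l'⟩ h2 h
    simp only [hX, coe_product, coe_range, Set.mem_prod, Set.mem_Iio] at h1 h2
    obtain ⟨rfl, rfl⟩ := ginj k l k' l' (by omega) h1.2 (by omega) h2.2 h
    rfl
  let TA := X.image (fun k => (u k, w * u k ^ (q + 1)))
  let TB := X.image (fun k => (u k / w, w ^ q * (u k / w) ^ (q + 1)))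
  let T0 := (range ε ×ˢ range (q - 1)).image (fun k => ((0 : F), v0 * u (0, k.2)))
  have cX : X.card = r * (q - 1) := by simp [hX]
  have cA : TA.card = r * (q - 1) := by
    rw [Finset.card_image_of_injOn, cX]
    intro k hk l hl h
    exact huinj hk hl (Prod.ext_iff.mp h).1
  have cB : TB.card = r * (q - 1) := by
    rw [Finset.card_image_of_injOn, cX]
    intro k hk l hl h
    exact huinj hk hl ((div_left_inj' hw0).mp (Prod.ext_iff.mp h).1)
  have c0 : T0.card = ε * (q - 1) := by
    rw [Finset.card_image_of_injOn]
    · simp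
    · rintro ⟨k, l⟩ h1 ⟨k', l'⟩ h2 h
      simp only [coe_product, coe_range, Set.mem_prod, Set.mem_Iio] at h1 h2
      have h3 := mul_left_cancel₀ hv0 (Prod.ext_iff.mp h).2
      obtain ⟨-, rfl⟩ := ginj 0 l 0 l' (by omega) h1.2 (by omega) h2.2 h3
      obtain rfl : k = k' := by omega
      rfl
  have hAB : Disjoint TA TB := by
    rw [Finset.disjoint_left]
    intro P h1 h2
    obtain ⟨k, -, rfl⟩ := Finset.mem_image.mp h1
    obtain ⟨l, -, hl⟩ := Finset.mem_image.mp h2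
    obtain ⟨e1, e2⟩ := Prod.ext_iff.mp hl
    simp only at e1 e2
    rw [e1] at e2
    exact hwq (mul_right_cancel₀ (pow_ne_zero _ (hu0 k)) e2)
  have hAB0 : Disjoint (TA ∪ TB) T0 := by
    rw [Finset.disjoint_left]
    intro P h1 h2
    obtain ⟨l, -, rfl⟩ := Finset.mem_image.mp h2
    rcases Finset.mem_union.mp h1 with h1 | h1
    · obtain ⟨k, -, hk⟩ := Finset.mem_image.mp h1
      exact hu0 k (Prod.ext_iff.mp hk).1
    · obtain ⟨k, -, hk⟩ := Finset.mem_image.mp h1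
      exact div_ne_zero (hu0 k) hw0 (Prod.ext_iff.mp hk).1
  let cc : ℕ → F := fun k => (w * g ^ (k * (q - 1)))⁻¹
  let p : Polynomial F := ∏ k ∈ range r, (Polynomial.X - Polynomial.C (cc k))
  have pm : p.Monic := Polynomial.monic_prod_of_monic _ _ fun k _ => Polynomial.monic_X_sub_C _
  have pd : p.natDegree = r := by
    rw [Polynomial.natDegree_prod_of_monic _ _ fun k _ => Polynomial.monic_X_sub_C _]
    simp
  have relgen : ∀ x y : F, y ≠ 0 → (∃ k < r, x ^ 2 / y = cc k) →
      x ^ (ε + 2 * r) = ∑ k ∈ range r, -p.coeff k * (x ^ (ε + 2 * k) * y ^ (r - k)) := by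
    intro x y hy ⟨k, hk, hxy⟩
    have h0 : p.eval (x ^ 2 / y) = 0 := by
      rw [Polynomial.eval_prod]
      exact Finset.prod_eq_zero (mem_range.mpr hk) (by simp [hxy])
    rw [Polynomial.eval_eq_sum_range, pd, Finset.sum_range_succ] at h0
    have hl : p.coeff r = 1 := by
      have := pm.coeff_natDegree
      rwa [pd] at this
    rw [hl, one_mul] at h0
    have h1 : x ^ (ε + 2 * r) = x ^ ε * y ^ r * (x ^ 2 / y) ^ r := by
      rw [div_pow, pow_add, pow_mul]; field_simp
    rw [h1, eq_neg_of_add_eq_zero_right h0, ← Finset.sum_neg_distrib, Finset.mul_sum]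
    refine Finset.sum_congr rfl fun l hl => ?_
    have hl := mem_range.mp hl
    have h2 : y ^ r = y ^ (r - l) * y ^ l := by rw [← pow_add]; congr 1; omega
    rw [div_pow, pow_add, pow_mul, h2]
    field_simp
  refine ⟨TA ∪ TB ∪ T0, fun k => -p.coeff k, ?_, ?_⟩
  · rw [Finset.card_union_of_disjoint hAB0, Finset.card_union_of_disjoint hAB, cA, cB, c0]; ring
  · intro P hP
    rcases Finset.mem_union.mp hP with hP | hP
    · rcases Finset.mem_union.mp hP with hP | hP
      · obtain ⟨k, hk, rfl⟩ := Finset.mem_image.mp hP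
        have hk1 : k.1 < r := by
          have := Finset.mem_product.mp hk; exact mem_range.mp this.1
        have hne : w * u k ^ (q + 1) ≠ 0 := mul_ne_zero hw0 (pow_ne_zero _ (hu0 k))
        refine ⟨hne, ?_, relgen _ _ hne ⟨k.1, hk1, ?_⟩⟩
        · simp only
          rw [mul_pow, hnorm]
          linear_combination u k ^ (q + 1) * hw1
        · have := hu0 k
          have h3 := pow_ne_zero (q - 1) this
          simp only [cc]
          rw [← huq, hqs]
          field_simp
      · obtain ⟨k, hk, rfl⟩ := Finset.mem_image.mp hP
        have hk1 : k.1 < r := by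
          have := Finset.mem_product.mp hk; exact mem_range.mp this.1
        have hd : u k / w ≠ 0 := div_ne_zero (hu0 k) hw0
        have hne : w ^ q * (u k / w) ^ (q + 1) ≠ 0 :=
          mul_ne_zero (pow_ne_zero _ hw0) (pow_ne_zero _ hd)
        refine ⟨hne, ?_, relgen _ _ hne ⟨k.1, hk1, ?_⟩⟩
        · simp only
          rw [mul_pow, hnorm, hqq]
          linear_combination (u k / w) ^ (q + 1) * hw1
        · have := hu0 k
          have h3 := pow_ne_zero (q - 1) this
          have h4 : w ^ q = w * w ^ (q - 1) := by rw [← pow_succ']; congr 1; omega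
          simp only [cc]
          rw [← huq, hqs, h4, div_pow _ _ (q - 1)]
          field_simp
    · obtain ⟨k, hk, rfl⟩ := Finset.mem_image.mp hP
      have hε1 : ε = 1 := by
        have := mem_range.mp (Finset.mem_product.mp hk).1; omega
      subst hε1
      refine ⟨mul_ne_zero hv0 (hu0 _), ?_, ?_⟩
      · have h1 : u (0, k.2) ^ (q - 1) = 1 := by rw [huq]; simp
        have h2 : u (0, k.2) ^ q = u (0, k.2) := by
          conv_lhs => rw [show q = q - 1 + 1 by omega, pow_succ, h1, one_mul]
        simp only
        rw [mul_pow, h2, zero_pow (by omega)]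
        linear_combination u (0, k.2) * hv1
      · simp only
        rw [zero_pow (by omega)]
        symm
        refine Finset.sum_eq_zero fun l _ => ?_
        rw [zero_pow (by omega)]; ring

lemma wt_lower {q : ℕ} {F : Type} [Field F] [Fintype F] (hq : 2 ≤ q) {M0 N0 : ℤ} (s a1 b1 : ℕ)
    (hsa : s < a1) (haq : a1 < q) (hsb : s < b1) (hbq : b1 < q) (hMN : M0 + N0 = q - 2 + s)
    (c : ↥(Dset q F) → F)
    (hc : c ∈ dualCode q F (M0 * (q + 1) - a1) (N0 * (q + 1) - b1)) (hc0 : c ≠ 0) :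
    s * (q - 1) ≤ wt c := by
  classical
  by_contra! hlt
  let _ : Fintype {P // c P ≠ 0} := Fintype.ofFinite _
  rw [wt, Nat.card_eq_fintype_card] at hlt
  have hV : ∀ P : ↥(Dset q F), (P : F × F).2 ≠ 0 := by
    rintro ⟨⟨x, y⟩, h1, h2⟩ h
    simp only at h1 h
    subst h
    rw [zero_pow (by omega), zero_add] at h1
    have : x = 0 := pow_eq_zero_iff (by omega) |>.mp h1.symm
    exact h2 (by rw [this]; rfl)
  have hV' : ∀ w : {P // c P ≠ 0}, (w.1 : F × F).2 ≠ 0 := fun w => hV w.1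
  have hcv : ∀ w : {P // c P ≠ 0}, (w.1 : F × F).2 ^ q + (w.1 : F × F).2 =
      (w.1 : F × F).1 ^ (q + 1) := fun w => w.1.2.1
  have hall := lower (c := fun w : {P // c P ≠ 0} => c w.1) (U := fun w => (w.1 : F × F).1)
    (V := fun w => (w.1 : F × F).2) hq hV' hcv
    (fun w z h1 h2 => Subtype.ext (Subtype.ext (Prod.ext h1 h2)))
    s a1 b1 hsa haq hsb hbq hMN hlt ?_
  · apply hc0
    funext P
    by_contra hP
    exact hP (hall ⟨P, hP⟩)
  · apply perp_of_S hq (ph_rec hV' hcv)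
    intro i j h1 h2 h3
    have := hc (evalVec q F ((i : ℤ), j)) (Submodule.subset_span
      ⟨((i : ℤ), j), ⟨by positivity, Int.ofNat_le.mpr h1, h2, h3⟩, rfl⟩)
    refine Eq.trans ?_ this
    rw [ph]
    refine Finset.sum_of_injOn Subtype.val Subtype.val_injective.injOn (by simp) ?_ ?_
    · intro P _ hP
      have : c P = 0 := by
        by_contra h
        exact hP ⟨⟨P, h⟩, by simp, rfl⟩
      rw [this, zero_mul]
    · intro w _
      simp [evalVec]

lemma wt_upper {q : ℕ} {F : Type} [Field F] [Fintype F] (hq : 2 ≤ q) (hpp : IsPrimePow q)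
    (hF : Fintype.card F = q ^ 2) {M0 N0 : ℤ} (s a1 b1 : ℕ) (hs : 1 ≤ s)
    (hsa : s < a1) (haq : a1 < q) (hsb : s < b1) (hbq : b1 < q) (hMN : M0 + N0 = q - 2 + s) :
    ∃ c ∈ dualCode q F (M0 * (q + 1) - a1) (N0 * (q + 1) - b1), c ≠ 0 ∧ wt c ≤ s * (q - 1) := by
  classical
  have hsr : s = s % 2 + 2 * (s / 2) := (Nat.mod_add_div s 2).symm
  obtain ⟨T, e, hT, hP⟩ := exists_points hq hpp hF (s % 2) (s / 2) (by omega) (by omega)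
  rw [← hsr] at hT hP
  obtain ⟨c, hc0, hc⟩ := upper_core (W := ↥T) (U := fun w => w.1.1) (V := fun w => w.1.2) hq
    (fun w => (hP w.1 w.2).1) (fun w => (hP w.1 w.2).2.1) s a1 b1 hs hsa haq hsb hbq hMN
    (by simpa using hT) (s % 2) (s / 2) hsr e (fun w => (hP w.1 w.2).2.2)
  let f : ↥T → ↥(Dset q F) := fun w => ⟨w.1, (hP w.1 w.2).2.1, fun h => (hP w.1 w.2).1 (by
    rw [h]; rfl)⟩
  have hf : Function.Injective f := fun w z h => Subtype.ext (congrArg (fun P => P.1) h)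
  let C : ↥(Dset q F) → F := fun P => if h : P.1 ∈ T then c ⟨P.1, h⟩ else 0
  have hCf : ∀ w, C (f w) = c w := fun w => by
    have : (f w).1 ∈ T := w.2
    simp only [C, dif_pos this]
    rfl
  refine ⟨C, ?_, ?_, ?_⟩
  · have key : ∀ ij ∈ S q (M0 * (q + 1) - a1) (N0 * (q + 1) - b1),
        ∑ P, C P * evalVec q F ij P = 0 := by
      rintro ⟨i, j⟩ ⟨h0, h1, h2, h3⟩
      simp only at h0 h1 h2 h3
      lift i to ℕ using h0
      rw [← hc i j h2 h3, ph]
      symm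
      refine Finset.sum_of_injOn f hf.injOn (by simp) ?_ ?_
      · intro P _ hP
        have : C P = 0 := by
          simp only [C]
          split_ifs with h
          · exact absurd ⟨⟨P.1, h⟩, by simp, rfl⟩ hP
          · rfl
        rw [this, zero_mul]
      · intro w _
        rw [hCf]
        simp [evalVec, f]
    intro w hw
    induction hw using Submodule.span_induction with
    | mem x hx =>
      obtain ⟨ij, hij, rfl⟩ := hx
      exact key ij hij
    | zero => simp
    | add x y _ _ h1 h2 =>
      simp only [Pi.add_apply, mul_add, Finset.sum_add_distrib, h1, h2, add_zero]
    | smul t x _ h =>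
      simp only [Pi.smul_apply, smul_eq_mul, mul_left_comm _ t, ← Finset.mul_sum, h, mul_zero]
  · intro h
    apply hc0
    funext w
    rw [← hCf, h]; rfl
  · rw [wt, ← hT, ← Fintype.card_coe T, ← Nat.card_eq_fintype_card]
    have hmem : ∀ P : {P // C P ≠ 0}, P.1.1 ∈ T := by
      intro P
      by_contra h
      exact P.2 (by simp only [C, dif_neg h])
    exact Nat.card_le_card_of_injective (fun P : {P // C P ≠ 0} => (⟨P.1.1, hmem P⟩ : ↥T))
      (fun P Q h => Subtype.ext (Subtype.ext (congrArg (fun x => x.1) h)))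

end Helpers

/-- Theorem 3.3, cases 3 and 3′: if `a₀ + b₀ < a₁ < q` and `a₀ + b₀ < b₁ < q`, then
`d(C(K + a P∞ + b P₀)^⊥) = d* + a₁ + b₁ - 2(a₀ + b₀)`, where `K = (q-2)(q+1) P∞`. -/
theorem minDist_case3 (q : ℕ) (hq : 2 ≤ q) (hpp : IsPrimePow q)
    (F : Type) [Field F] [Fintype F] (hF : Fintype.card F = q ^ 2)
    (a₀ b₀ a₁ b₁ a b : ℤ)
    (ha₁ : 0 ≤ a₁ ∧ a₁ ≤ (q : ℤ)) (hb₁ : 0 ≤ b₁ ∧ b₁ ≤ (q : ℤ))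
    (ha : a = a₀ * ((q : ℤ) + 1) - a₁) (hb : b = b₀ * ((q : ℤ) + 1) - b₁)
    (hdeg : 0 ≤ a + b ∧ a + b ≤ (q : ℤ) ^ 3 - 1)
    (hrange : (q : ℤ) < a + b ∨ (a + b ≤ (q : ℤ) ∧ a₁ ≠ 0 ∧ b₁ ≠ 0))
    (hcase : (a₀ + b₀ < a₁ ∧ a₁ < (q : ℤ)) ∧ (a₀ + b₀ < b₁ ∧ b₁ < (q : ℤ))) :
    (minDist q F (((q : ℤ) - 2) * ((q : ℤ) + 1) + a) b : ℤ) =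
      a + b + a₁ + b₁ - 2 * (a₀ + b₀) := by
  obtain ⟨⟨h1, h2⟩, h3, h4⟩ := hcase
  have hq' : (2 : ℤ) ≤ q := by exact_mod_cast hq
  have hs1 : 1 ≤ a₀ + b₀ := by
    by_contra! h
    have h5 : (a₀ + b₀) * ((q : ℤ) + 1) ≤ 0 := mul_nonpos_of_nonpos_of_nonneg (by omega) (by omega)
    have h6 : a + b = (a₀ + b₀) * ((q : ℤ) + 1) - a₁ - b₁ := by rw [ha, hb]; ring
    have h7 : a₁ = 0 ∧ b₁ = 0 := by omega
    obtain ⟨rfl, rfl⟩ := h7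
    have h8 : (a₀ + b₀) * ((q : ℤ) + 1) ≤ (-1) * ((q : ℤ) + 1) :=
      mul_le_mul_of_nonneg_right (by omega) (by omega)
    omega
  obtain ⟨s, hs⟩ : ∃ s : ℕ, (s : ℤ) = a₀ + b₀ := ⟨(a₀ + b₀).toNat, by omega⟩
  obtain ⟨x, rfl⟩ : ∃ x : ℕ, a₁ = x := ⟨a₁.toNat, by omega⟩
  obtain ⟨y, rfl⟩ : ∃ y : ℕ, b₁ = y := ⟨b₁.toNat, by omega⟩
  have em : ((q : ℤ) - 2) * ((q : ℤ) + 1) + a = (q - 2 + a₀) * (q + 1) - x := by rw [ha]; ring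
  have hMN : ((q : ℤ) - 2 + a₀) + b₀ = q - 2 + s := by rw [hs]; ring
  have hval : minDist q F ((q - 2 + a₀) * (q + 1) - x) (b₀ * (q + 1) - y) = s * (q - 1) := by
    obtain ⟨c, hc, hc0, hle⟩ := wt_upper hq hpp hF s x y (by omega) (by omega) (by omega)
      (by omega) (by omega) hMN
    have hlow := wt_lower (F := F) hq s x y (by omega) (by omega) (by omega) (by omega) hMN
    refine le_antisymm (le_trans (Nat.sInf_le ⟨c, hc, hc0, rfl⟩) hle) ?_
    refine le_csInf ⟨_, c, hc, hc0, rfl⟩ ?_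
    rintro w ⟨c', hc', hc0', rfl⟩
    exact hlow c' hc' hc0'
  rw [em, hb, hval, ha]
  push_cast [show 1 ≤ q by omega]
  rw [hs]
  ring

end HermitianTwoPoint
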